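/- arXiv:1403.6312 — 2 statements merged into one kernel-verified Lean document; each statement's English description precedes it below -/
import Mathlib

section
/- Under the hypotheses of the regularized Newton dynamic with S ≠ ∅, every orbit x(·) of the system v(t) ∈ ∂Φ(x(t)), λẋ(t) + v̇(t) + v(t) + B(x(t)) = 0 converges weakly, as t → ∞, to an element of S = {z : 0 ∈ ∂Φ(z) + Bz}; moreover v(t) + B(x(t)) → 0 strongly and B(x(t)) → Bz strongly, where Bz is the (unique) common value of B on S. -/
open scoped RealInnerProductSpace
open MeasureTheory Filter Set

/-- `v` belongs to the convex subdifferential of `Φ` at `x`. -/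
def InSubdiff {H : Type*} [NormedAddCommGroup H] [InnerProductSpace ℝ H]
    (Φ : H → EReal) (x v : H) : Prop :=
  ∀ y : H, Φ x + ((⟪v, y - x⟫ : ℝ) : EReal) ≤ Φ y

/-- Locally absolutely continuous on `[0, ∞)` with a.e. derivative `x'`. -/
def IsLocAC {H : Type*} [NormedAddCommGroup H] [NormedSpace ℝ H]
    (x x' : ℝ → H) : Prop :=
  (∀ a b : ℝ, 0 ≤ a → 0 ≤ b → IntegrableOn x' (Set.uIcc a b)) ∧
    ∀ s t : ℝ, 0 ≤ s → 0 ≤ t → x t - x s = ∫ u in s..t, x' u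

open scoped Topology

lemma ac_dom {X Y Z : Type*} [PseudoMetricSpace X] [PseudoMetricSpace Y] [PseudoMetricSpace Z]
    {x : ℝ → X} {v : ℝ → Y} {F : ℝ → Z} {a b C : ℝ}
    (hx : AbsolutelyContinuousOnInterval x a b) (hv : AbsolutelyContinuousOnInterval v a b)
    (h : ∀ s ∈ uIcc a b, ∀ t ∈ uIcc a b,
      dist (F s) (F t) ≤ C * (dist (x s) (x t) + dist (v s) (v t))) :
    AbsolutelyContinuousOnInterval F a b := by
  unfold AbsolutelyContinuousOnInterval at *
  have h1 := (hx.add hv).const_mul C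
  simp only [add_zero, mul_zero] at h1
  refine squeeze_zero' ?_ ?_ h1
  · exact Eventually.of_forall fun E => Finset.sum_nonneg fun _ _ => dist_nonneg
  · refine (eventually_of_mem (mem_inf_of_right (mem_principal_self _)) ?_)
    intro E hE
    rw [← Finset.sum_add_distrib, Finset.mul_sum]
    exact Finset.sum_le_sum fun i hi => h _ (hE.1 i hi).1 _ (hE.1 i hi).2

section
variable {H : Type*} [NormedAddCommGroup H] [InnerProductSpace ℝ H]

lemma ac_const (z : H) (a b : ℝ) : AbsolutelyContinuousOnInterval (fun _ => z) a b := by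
  unfold AbsolutelyContinuousOnInterval
  simp only [dist_self, Finset.sum_const_zero]
  exact tendsto_const_nhds

lemma ac_inner {x v : ℝ → H} {a b : ℝ}
    (hx : AbsolutelyContinuousOnInterval x a b) (hv : AbsolutelyContinuousOnInterval v a b) :
    AbsolutelyContinuousOnInterval (fun t => ⟪x t, v t⟫) a b := by
  obtain ⟨C, hC⟩ := hx.exists_bound
  obtain ⟨D, hD⟩ := hv.exists_bound
  refine ac_dom (C := max C D) hx hv fun s hs t ht => ?_
  have e : ⟪x s, v s⟫ - ⟪x t, v t⟫ = ⟪x s - x t, v s⟫ + ⟪x t, v s - v t⟫ := by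
    simp only [inner_sub_left, inner_sub_right]; ring
  rw [Real.dist_eq, e, dist_eq_norm, dist_eq_norm]
  have h1 := abs_real_inner_le_norm (x s - x t) (v s)
  have h2 := abs_real_inner_le_norm (x t) (v s - v t)
  have h3 := mul_le_mul_of_nonneg_left ((hD s hs).trans (le_max_right C D)) (norm_nonneg (x s - x t))
  have h4 := mul_le_mul_of_nonneg_right ((hC t ht).trans (le_max_left C D)) (norm_nonneg (v s - v t))
  have := abs_add_le ⟪x s - x t, v s⟫ ⟪x t, v s - v t⟫
  nlinarith

lemma locac_ii {x x' : ℝ → H} (hx : IsLocAC x x') {s t : ℝ} (hs : 0 ≤ s) (ht : 0 ≤ t) :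
    IntervalIntegrable x' volume s t :=
  (hx.1 s t hs ht).intervalIntegrable

lemma locac_le {x x' : ℝ → H} (hx : IsLocAC x x') {s t : ℝ} (hs : 0 ≤ s) (hst : s ≤ t) :
    ‖x t - x s‖ ≤ ∫ u in s..t, ‖x' u‖ := by
  rw [hx.2 s t hs (hs.trans hst)]
  exact intervalIntegral.norm_integral_le_integral_norm hst

lemma locac_ac {x x' : ℝ → H} (hx : IsLocAC x x') {T : ℝ} (hT : 0 ≤ T) :
    AbsolutelyContinuousOnInterval x 0 T := by
  have h := (locac_ii hx le_rfl hT).norm.absolutelyContinuousOnInterval_intervalIntegral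
    (c := 0) left_mem_uIcc
  refine ac_dom (C := 1) h h fun s hs t ht => ?_
  rw [uIcc_of_le hT] at hs ht
  rw [dist_eq_norm, hx.2 t s ht.1 hs.1, Real.dist_eq,
    intervalIntegral.integral_interval_sub_left (locac_ii hx le_rfl hs.1).norm
      (locac_ii hx le_rfl ht.1).norm]
  have := intervalIntegral.norm_integral_le_abs_integral_norm (f := x') (μ := volume) (a := t) (b := s)
  have := abs_nonneg (∫ u in t..s, ‖x' u‖)
  linarith

lemma locac_deriv [CompleteSpace H] {x x' : ℝ → H} (hx : IsLocAC x x') :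
    ∀ᵐ t, 0 < t → HasDerivAt x (x' t) t := by
  have h : ∀ n : ℕ, ∀ᵐ t, t ∈ uIcc (0:ℝ) n → ∀ c ∈ uIcc (0:ℝ) n,
      HasDerivAt (fun t => ∫ u in c..t, x' u) (x' t) t :=
    fun n => (locac_ii hx le_rfl n.cast_nonneg).ae_hasDerivAt_integral
  filter_upwards [ae_all_iff.2 h] with t ht h0
  obtain ⟨n, hn⟩ := exists_nat_ge t
  have h1 := ht n (by rw [uIcc_of_le (by positivity)]; exact ⟨h0.le, hn⟩) 0 left_mem_uIcc
  refine (h1.const_add (x 0)).congr_of_eventuallyEq ?_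
  filter_upwards [lt_mem_nhds h0] with s hs
  rw [← hx.2 0 s le_rfl hs.le]; abel

lemma locac_cont {x x' : ℝ → H} (hx : IsLocAC x x') : ContinuousOn x (Ici 0) := by
  intro t ht
  have h := (locac_ac hx (show (0:ℝ) ≤ t + 1 by linarith [mem_Ici.1 ht])).continuousOn
  rw [uIcc_of_le (by linarith [mem_Ici.1 ht])] at h
  refine (h t ⟨ht, by linarith⟩).mono_of_mem_nhdsWithin ?_
  rw [← Ici_inter_Iic]
  exact inter_mem_nhdsWithin _ (Iic_mem_nhds (by linarith))

lemma locac_meas {x x' : ℝ → H} (hx : IsLocAC x x') :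
    AEStronglyMeasurable x' (volume.restrict (Ioi 0)) := by
  have : Ioi (0:ℝ) ⊆ ⋃ n : ℕ, uIcc (0:ℝ) n := by
    intro t ht
    obtain ⟨n, hn⟩ := exists_nat_ge t
    refine mem_iUnion.2 ⟨n, ?_⟩
    rw [uIcc_of_le (by positivity)]; exact ⟨(mem_Ioi.1 ht).le, hn⟩
  refine AEStronglyMeasurable.mono_measure ?_ (Measure.restrict_mono this le_rfl)
  exact aestronglyMeasurable_iUnion_iff.2 fun n => (hx.1 0 n le_rfl n.cast_nonneg).1

lemma inner_deriv_nonneg {x v : ℝ → H} {t : ℝ} {a b : H} (ht : 0 < t)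
    (hm : ∀ s, 0 ≤ s → ∀ r, 0 ≤ r → 0 ≤ ⟪v s - v r, x s - x r⟫)
    (hx : HasDerivAt x a t) (hv : HasDerivAt v b t) : 0 ≤ ⟪b, a⟫ := by
  have h := (hasDerivAt_iff_tendsto_slope.1 hv).inner (hasDerivAt_iff_tendsto_slope.1 hx) (𝕜 := ℝ)
  refine ge_of_tendsto h ?_
  filter_upwards [mem_nhdsWithin_of_mem_nhds (lt_mem_nhds ht)] with s hs
  simp only [slope, vsub_eq_sub, inner_smul_left, inner_smul_right]
  have := hm s (le_of_lt hs) t ht.le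
  simp only [conj_trivial, ← mul_assoc]
  exact mul_nonneg (mul_self_nonneg _) this

/-- energy lemma -/
lemma energy {F F' q : ℝ → ℝ} {m : ℝ}
    (hF : ∀ T, 0 ≤ T → AbsolutelyContinuousOnInterval F 0 T)
    (hd : ∀ᵐ t, 0 < t → HasDerivAt F (F' t) t)
    (hq : ∀ᵐ t, 0 < t → F' t ≤ - q t)
    (hq0 : ∀ t, 0 ≤ q t)
    (hqm : AEStronglyMeasurable q (volume.restrict (Ioi 0)))
    (hm : ∀ t, 0 ≤ t → m ≤ F t) :
    AntitoneOn F (Ici 0) ∧ IntegrableOn q (Ioi 0) := by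
  have hle : ∀ s t, 0 ≤ s → s ≤ t →
      IntegrableOn q (Ioc s t) ∧ F t ≤ F s - ∫ u in s..t, q u := by
    intro s t hs hst
    have hac : AbsolutelyContinuousOnInterval F s t := (hF t (hs.trans hst)).mono (by
      rw [uIcc_of_le hst, uIcc_of_le (hs.trans hst)]; exact Icc_subset_Icc_left hs)
    have hi := hac.intervalIntegrable_deriv
    have he := hac.integral_deriv_eq_sub
    have hle : ∀ᵐ u ∂(volume.restrict (Ioc s t)), q u ≤ - deriv F u := by
      rw [ae_restrict_iff' measurableSet_Ioc]
      filter_upwards [hd, hq] with u h1 h2 hu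
      have hu0 : 0 < u := hs.trans_lt hu.1
      rw [(h1 hu0).deriv]; linarith [h2 hu0]
    have hqi : IntegrableOn q (Ioc s t) := by
      refine Integrable.mono' (g := fun u => - deriv F u) ?_ ?_ ?_
      · exact ((intervalIntegrable_iff_integrableOn_Ioc_of_le hst).1 hi).neg
      · exact hqm.mono_measure (Measure.restrict_mono
          (fun u hu => hs.trans_lt hu.1) le_rfl)
      · filter_upwards [hle] with u hu
        rwa [Real.norm_of_nonneg (hq0 u)]
    refine ⟨hqi, ?_⟩
    have := intervalIntegral.integral_mono_ae_restrict hst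
      ((intervalIntegrable_iff_integrableOn_Ioc_of_le hst).2 hqi) hi.neg (by
        rw [← restrict_Ioc_eq_restrict_Icc]; exact hle)
    simp only [Pi.neg_apply, intervalIntegral.integral_neg] at this
    linarith
  refine ⟨fun s hs t ht hst => ?_, ?_⟩
  · have := (hle s t hs hst).2
    have := intervalIntegral.integral_nonneg hst (fun u _ => hq0 u) (μ := volume)
    linarith
  · refine integrableOn_Ioi_of_intervalIntegral_norm_bounded (l := atTop)
      (b := fun n : ℕ => (n : ℝ)) (F 0 - m) 0 ?_ tendsto_natCast_atTop_atTop ?_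
    · exact fun n => (hle 0 n le_rfl n.cast_nonneg).1
    · refine Eventually.of_forall fun n => ?_
      have h1 := (hle 0 n le_rfl n.cast_nonneg).2
      have h2 := hm n n.cast_nonneg
      simp only [Real.norm_of_nonneg (hq0 _)]
      linarith

/-- Barbalat type lemma -/
lemma barbalat {x x' y : ℝ → H} {q : ℝ → ℝ} {K : ℝ}
    (hx : IsLocAC x x')
    (hy : ∀ s t, 0 ≤ s → 0 ≤ t → ‖y t - y s‖ ≤ K * ‖x t - x s‖)
    (hq : IntegrableOn q (Ioi 0))
    (hx'q : ∀ᵐ t, 0 < t → ‖x' t‖ ^ 2 ≤ q t)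
    (hyq : ∀ᵐ t, 0 < t → ‖y t‖ ^ 2 ≤ q t) :
    Tendsto y atTop (𝓝 0) := by
  have hqi : ∀ s t, 0 ≤ s → s ≤ t → IntervalIntegrable q volume s t := fun s t hs hst =>
    (intervalIntegrable_iff_integrableOn_Ioc_of_le hst).2
      (hq.mono_set fun u hu => hs.trans_lt hu.1)
  have key : ∀ s, 0 ≤ s → ‖y s‖ ^ 2 ≤ (2 + 2 * K ^ 2) * ∫ u in s..(s+1), q u := by
    intro s hs
    set Q := ∫ u in s..(s+1), q u with hQ
    have hx2 : ∀ t ∈ Icc s (s+1), ‖x t - x s‖ ^ 2 ≤ Q := by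
      intro t ht
      have hle := locac_le hx hs ht.1
      set m := ∫ u in s..t, ‖x' u‖ with hm
      have hm0 : 0 ≤ m := (norm_nonneg _).trans hle
      have h1 : ∫ u in s..t, 2 * m * ‖x' u‖ ≤ ∫ u in s..t, (q u + m ^ 2) := by
        refine intervalIntegral.integral_mono_ae_restrict ht.1
          ((locac_ii hx hs (hs.trans ht.1)).norm.const_mul _)
          ((hqi s t hs ht.1).add intervalIntegrable_const) ?_
        rw [← restrict_Ioc_eq_restrict_Icc]
        refine (ae_restrict_iff' measurableSet_Ioc).2 ?_
        filter_upwards [hx'q] with u hu hus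
        have := hu (hs.trans_lt hus.1)
        show 2 * m * ‖x' u‖ ≤ q u + m ^ 2
        nlinarith [sq_nonneg (‖x' u‖ - m)]
      rw [intervalIntegral.integral_const_mul, intervalIntegral.integral_add (hqi s t hs ht.1)
        intervalIntegrable_const, intervalIntegral.integral_const, smul_eq_mul, ← hm] at h1
      have h2 : ∫ u in s..t, q u ≤ Q := by
        have : 0 ≤ ∫ u in t..(s+1), q u := by
          refine intervalIntegral.integral_nonneg_of_ae_restrict ht.2 ?_
          rw [← restrict_Ioc_eq_restrict_Icc]
          refine (ae_restrict_iff' measurableSet_Ioc).2 ?_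
          filter_upwards [hx'q] with u hu hus
          exact (sq_nonneg _).trans (hu ((hs.trans ht.1).trans_lt hus.1))
        have := intervalIntegral.integral_add_adjacent_intervals (hqi s t hs ht.1)
          (hqi t (s+1) (hs.trans ht.1) ht.2)
        linarith
      have h3 : (t - s) * m ^ 2 ≤ 1 * m ^ 2 :=
        mul_le_mul_of_nonneg_right (by linarith [ht.2]) (sq_nonneg m)
      have h4 : ‖x t - x s‖ ^ 2 ≤ m ^ 2 := pow_le_pow_left₀ (norm_nonneg _) hle 2
      nlinarith
    have h5 : ∫ u in s..(s+1), (‖y s‖ ^ 2 : ℝ) ≤ ∫ u in s..(s+1), (2 * q u + 2 * K ^ 2 * Q) := by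
      refine intervalIntegral.integral_mono_ae_restrict (by linarith) intervalIntegrable_const
        (((hqi s (s+1) hs (by linarith)).const_mul _).add intervalIntegrable_const) ?_
      rw [← restrict_Ioc_eq_restrict_Icc]
      refine (ae_restrict_iff' measurableSet_Ioc).2 ?_
      filter_upwards [hyq] with u hu hus
      have a1 := hu (hs.trans_lt hus.1)
      have a2 := hx2 u ⟨hus.1.le, hus.2⟩
      have a3 := hy s u hs (hs.trans hus.1.le)
      have a4 : ‖y s‖ ≤ ‖y u‖ + ‖y u - y s‖ := by
        have := norm_sub_le (y u) (y u - y s)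
        rwa [sub_sub_cancel] at this
      have a5 : ‖y u - y s‖ ^ 2 ≤ (K * ‖x u - x s‖) ^ 2 := pow_le_pow_left₀ (norm_nonneg _) a3 2
      have a6 : ‖y s‖ ^ 2 ≤ (‖y u‖ + ‖y u - y s‖) ^ 2 := pow_le_pow_left₀ (norm_nonneg _) a4 2
      have a7 := mul_le_mul_of_nonneg_left a2 (sq_nonneg K)
      show ‖y s‖ ^ 2 ≤ 2 * q u + 2 * K ^ 2 * Q
      nlinarith [sq_nonneg (‖y u‖ - ‖y u - y s‖)]
    rw [intervalIntegral.integral_add ((hqi s (s+1) hs (by linarith)).const_mul _)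
      intervalIntegrable_const, intervalIntegral.integral_const, intervalIntegral.integral_const,
      intervalIntegral.integral_const_mul, ← hQ] at h5
    simp only [add_sub_cancel_left, one_smul] at h5
    linarith
  have hlim : Tendsto (fun s => ∫ u in s..(s+1), q u) atTop (𝓝 0) := by
    have h1 := intervalIntegral_tendsto_integral_Ioi 0 hq tendsto_id
    have h2 := intervalIntegral_tendsto_integral_Ioi 0 hq (tendsto_atTop_add_const_right atTop (1:ℝ) tendsto_id)
    have h3 := h2.sub h1
    rw [sub_self] at h3
    refine h3.congr' ?_
    filter_upwards [eventually_ge_atTop 0] with s hs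
    exact intervalIntegral.integral_interval_sub_left (hqi 0 (s+1) le_rfl (by linarith))
      (hqi 0 s le_rfl hs)
  have hsq : Tendsto (fun s => ‖y s‖ ^ 2) atTop (𝓝 0) := by
    have h := hlim.const_mul (2 + 2 * K ^ 2)
    rw [mul_zero] at h
    refine squeeze_zero' (Eventually.of_forall fun _ => sq_nonneg _) ?_ h
    filter_upwards [eventually_ge_atTop 0] with s hs using key s hs
  rw [tendsto_zero_iff_norm_tendsto_zero]
  have := hsq.sqrt
  simpa [Real.sqrt_sq (norm_nonneg _)] using this

end

section
variable {H : Type*} [NormedAddCommGroup H] [InnerProductSpace ℝ H]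

lemma phi_ac {x v : ℝ → H} {φ : ℝ → ℝ} {T : ℝ} (hT : 0 ≤ T)
    (hφ : ∀ s t, 0 ≤ s → 0 ≤ t → φ s + ⟪v s, x t - x s⟫ ≤ φ t)
    (hx : AbsolutelyContinuousOnInterval x 0 T) (hv : AbsolutelyContinuousOnInterval v 0 T) :
    AbsolutelyContinuousOnInterval φ 0 T := by
  obtain ⟨C, hC⟩ := hv.exists_bound
  refine ac_dom (C := C) hx hx fun s hs t ht => ?_
  have h1 := hC s hs
  have h2 := hC t ht
  rw [uIcc_of_le hT] at hs ht
  have a1 := hφ s t hs.1 ht.1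
  have a2 := hφ t s ht.1 hs.1
  have b1 := abs_real_inner_le_norm (v s) (x t - x s)
  have b2 := abs_real_inner_le_norm (v t) (x s - x t)
  rw [norm_sub_rev] at b1
  have c1 := mul_le_mul_of_nonneg_right h1 (norm_nonneg (x s - x t))
  have c2 := mul_le_mul_of_nonneg_right h2 (norm_nonneg (x s - x t))
  have d := mul_nonneg ((norm_nonneg _).trans h1) (norm_nonneg (x s - x t))
  rw [Real.dist_eq, dist_eq_norm, abs_le]
  constructor <;> linarith [abs_le.1 b1, abs_le.1 b2]

lemma phi_deriv {x v : ℝ → H} {φ : ℝ → ℝ} {t : ℝ} {a : H} (ht : 0 < t)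
    (hφ : ∀ s t, 0 ≤ s → 0 ≤ t → φ s + ⟪v s, x t - x s⟫ ≤ φ t)
    (hx : HasDerivAt x a t) (hv : ContinuousAt v t) : HasDerivAt φ ⟪v t, a⟫ t := by
  have hs := hasDerivAt_iff_tendsto_slope.1 hx
  have hv' : Tendsto v (𝓝[≠] t) (𝓝 (v t)) := hv.mono_left nhdsWithin_le_nhds
  have h1 : Tendsto (fun s => ⟪v t, slope x t s⟫) (𝓝[≠] t) (𝓝 ⟪v t, a⟫) :=
    tendsto_const_nhds.inner hs
  have h2 : Tendsto (fun s => ⟪v s, slope x t s⟫) (𝓝[≠] t) (𝓝 ⟪v t, a⟫) := hv'.inner hs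
  rw [hasDerivAt_iff_tendsto_slope]
  have h3 := h1.min h2
  have h4 := h1.max h2
  rw [min_self] at h3
  rw [max_self] at h4
  refine tendsto_of_tendsto_of_tendsto_of_le_of_le' h3 h4 ?_ ?_
  all_goals
    filter_upwards [mem_nhdsWithin_of_mem_nhds (lt_mem_nhds ht), self_mem_nhdsWithin] with s hs0 hne
    have a1 := hφ s t (le_of_lt hs0) ht.le
    have a2 := hφ t s ht.le (le_of_lt hs0)
    rw [← neg_sub (x s), inner_neg_right] at a1
    simp only [slope, vsub_eq_sub, inner_smul_right, smul_eq_mul]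
    rcases lt_or_gt_of_ne hne with h | h
    · have : (s - t)⁻¹ ≤ 0 := inv_nonpos.2 (by linarith)
      first
      | exact min_le_of_right_le (mul_le_mul_of_nonpos_left (by linarith) this)
      | exact le_max_of_le_left (mul_le_mul_of_nonpos_left (by linarith) this)
    · have : 0 ≤ (s - t)⁻¹ := inv_nonneg.2 (by linarith)
      first
      | exact min_le_of_left_le (mul_le_mul_of_nonneg_left (by linarith) this)
      | exact le_max_of_le_right (mul_le_mul_of_nonneg_left (by linarith) this)

lemma antitone_lim {F : ℝ → ℝ} {m : ℝ} (h : AntitoneOn F (Ici 0)) (hm : ∀ t, 0 ≤ t → m ≤ F t) :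
    ∃ l, Tendsto F atTop (𝓝 l) := by
  have ha : Antitone (fun t => F (max t 0)) := fun s t hst =>
    h (mem_Ici.2 (le_max_right _ _)) (mem_Ici.2 (le_max_right _ _)) (max_le_max_right _ hst)
  refine ⟨_, (tendsto_atTop_ciInf ha ⟨m, ?_⟩).congr' ?_⟩
  · rintro _ ⟨t, rfl⟩; exact hm _ (le_max_right _ _)
  · filter_upwards [eventually_ge_atTop 0] with t ht
    rw [max_eq_left ht]

lemma core [CompleteSpace H] {φ : ℝ → ℝ} {β : ℝ} (hβ : 0 < β) {B : H → H}
    (hcoco : ∀ x y : H, β * ‖B x - B y‖ ^ 2 ≤ ⟪B x - B y, x - y⟫)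
    {lam : ℝ} (hlam : 0 < lam)
    {x v x' v' : ℝ → H}
    (hx : IsLocAC x x') (hv : IsLocAC v v')
    (hφ : ∀ s t, 0 ≤ s → 0 ≤ t → φ s + ⟪v s, x t - x s⟫ ≤ φ t)
    (heq : ∀ᵐ t ∂(volume.restrict (Ioi (0 : ℝ))),
      lam • x' t + v' t + v t + B (x t) = 0)
    {z : H} {Φz : ℝ} (hz1 : ∀ t, 0 ≤ t → Φz + ⟪-B z, x t - z⟫ ≤ φ t)
    (hz2 : ∀ t, 0 ≤ t → φ t + ⟪v t, z - x t⟫ ≤ Φz) :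
    AntitoneOn (fun t => lam / 2 * ⟪x t - z, x t - z⟫ - φ t - ⟪v t, z - x t⟫) (Ici 0) ∧
    Tendsto v atTop (𝓝 (-B z)) ∧ Tendsto (fun t => B (x t)) atTop (𝓝 (B z)) := by
  set b := B z with hb
  have hE0 : ∀ t, 0 ≤ t → -Φz ≤ lam / 2 * ⟪x t - z, x t - z⟫ - φ t - ⟪v t, z - x t⟫ := by
    intro t ht
    have h1 := hz2 t ht
    have h2 : 0 ≤ lam / 2 * ⟪x t - z, x t - z⟫ := by
      rw [real_inner_self_eq_norm_sq]; positivity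
    linarith
  have acx : ∀ T, 0 ≤ T → AbsolutelyContinuousOnInterval x 0 T := fun T hT => locac_ac hx hT
  have acv : ∀ T, 0 ≤ T → AbsolutelyContinuousOnInterval v 0 T := fun T hT => locac_ac hv hT
  have acφ : ∀ T, 0 ≤ T → AbsolutelyContinuousOnInterval φ 0 T := fun T hT =>
    phi_ac hT hφ (acx T hT) (acv T hT)
  have hEac : ∀ T, 0 ≤ T → AbsolutelyContinuousOnInterval
      (fun t => lam / 2 * ⟪x t - z, x t - z⟫ - φ t - ⟪v t, z - x t⟫) 0 T := fun T hT => by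
    have hd : AbsolutelyContinuousOnInterval (fun t => x t - z) 0 T :=
      (acx T hT).sub (ac_const z 0 T)
    have hd' : AbsolutelyContinuousOnInterval (fun t => z - x t) 0 T :=
      (ac_const z 0 T).sub (acx T hT)
    exact (((ac_inner hd hd).const_mul (lam/2)).sub (acφ T hT)).sub (ac_inner (acv T hT) hd')
  have hPac : ∀ T, 0 ≤ T → AbsolutelyContinuousOnInterval
      (fun t => 1 / 2 * ⟪v t + b, v t + b⟫ + (φ t + ⟪b, x t⟫)) 0 T := fun T hT => by
    have hd : AbsolutelyContinuousOnInterval (fun t => v t + b) 0 T :=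
      (acv T hT).add (ac_const b 0 T)
    exact ((ac_inner hd hd).const_mul (1/2)).add
      ((acφ T hT).add (ac_inner (ac_const b 0 T) (acx T hT)))
  have hdx := locac_deriv hx
  have hdv := locac_deriv hv
  have heq' := (ae_restrict_iff' measurableSet_Ioi).1 heq
  have hEd : ∀ᵐ t, 0 < t → HasDerivAt
      (fun t => lam / 2 * ⟪x t - z, x t - z⟫ - φ t - ⟪v t, z - x t⟫)
      (- ⟪v t + B (x t), x t - z⟫) t := by
    filter_upwards [hdx, hdv, heq'] with t h1 h2 h3 ht
    have h1 := h1 ht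
    have h2 := h2 ht
    have h3 := h3 ht
    have hp := phi_deriv ht hφ h1 h2.continuousAt
    have hd := ((((h1.sub_const z).inner ℝ (h1.sub_const z)).const_mul (lam/2)).sub hp).sub
      (h2.inner ℝ (h1.const_sub z))
    refine hd.congr_deriv ?_
    have e : v t + B (x t) = - (lam • x' t + v' t) := by
      rw [eq_neg_iff_add_eq_zero, ← h3]; abel
    rw [e, real_inner_comm (x' t) (x t - z), ← neg_sub (x t) z]
    simp only [inner_neg_left, inner_neg_right, inner_add_left, inner_smul_left, conj_trivial]
    ring
  have hPd : ∀ᵐ t, 0 < t → HasDerivAt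
      (fun t => 1 / 2 * ⟪v t + b, v t + b⟫ + (φ t + ⟪b, x t⟫))
      (⟪v t + b, v' t⟫ + ⟪v t + b, x' t⟫) t := by
    filter_upwards [hdx, hdv] with t h1 h2 ht
    have h1 := h1 ht
    have h2 := h2 ht
    have hp := phi_deriv ht hφ h1 h2.continuousAt
    have hd := (((h2.add_const b).inner ℝ (h2.add_const b)).const_mul (1/2)).add
      (hp.add ((hasDerivAt_const t b).inner ℝ h1))
    refine hd.congr_deriv ?_
    rw [real_inner_comm (v' t) (v t + b), inner_add_left (v t) b (x' t)]
    simp only [inner_zero_left]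
    ring
  have hEle : ∀ t, 0 < t → - ⟪v t + B (x t), x t - z⟫ ≤ - (β * ‖B (x t) - b‖ ^ 2) := by
    intro t ht
    have h1 := hz1 t ht.le
    have h2 := hz2 t ht.le
    have h3 := hcoco (x t) z
    rw [← neg_sub (x t) z, inner_neg_right] at h2
    rw [inner_neg_left] at h1
    rw [inner_sub_left] at h3
    rw [inner_add_left]
    linarith
  have hmono : ∀ s, 0 ≤ s → ∀ r, 0 ≤ r → 0 ≤ ⟪v s - v r, x s - x r⟫ := by
    intro s hs r hr
    have h1 := hφ s r hs hr
    have h2 := hφ r s hr hs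
    rw [← neg_sub (x s) (x r), inner_neg_right] at h1
    rw [inner_sub_left]; linarith
  have hlip : ∀ y w, ‖B y - B w‖ ≤ 1 / β * ‖y - w‖ := by
    intro y w
    have h1 := hcoco y w
    have h2 := real_inner_le_norm (B y - B w) (y - w)
    rw [one_div, inv_mul_eq_div, le_div_iff₀ hβ]
    by_contra! hcon
    have h3 : 0 < ‖B y - B w‖ := by
      rcases (norm_nonneg (B y - B w)).eq_or_lt with h | h
      · rw [← h] at hcon; linarith [norm_nonneg (y - w)]
      · exact h
    nlinarith
  have hBc : Continuous B := by
    refine (LipschitzWith.of_dist_le_mul (K := ⟨1/β, by positivity⟩) fun y w => ?_).continuous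
    rw [dist_eq_norm, dist_eq_norm]; exact hlip y w
  refine ⟨?_, ?_⟩
  · refine (energy (q := fun _ => 0) hEac hEd ?_ (fun _ => le_rfl)
      aestronglyMeasurable_const hE0).1
    refine Eventually.of_forall fun t ht => (hEle t ht).trans ?_
    have : 0 ≤ β * ‖B (x t) - b‖ ^ 2 := by positivity
    linarith
  let q0 : ℝ → ℝ := fun t => ‖B (x t) - b‖ ^ 2 + ‖v' t‖ ^ 2 + ‖x' t‖ ^ 2
  obtain ⟨c, hc, hc1⟩ : ∃ c, 0 < c ∧ c * (1/2 + 1/(2*lam)) = β / 2 :=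
    ⟨β / 2 / (1/2 + 1/(2*lam)), by positivity, by field_simp⟩
  obtain ⟨δ, hδ, hδ1, hδ2, hδ3⟩ : ∃ δ, 0 < δ ∧ δ ≤ β / 2 ∧ δ ≤ c / 2 ∧ δ ≤ c * lam / 2 :=
    ⟨min (β/2) (min (c/2) (c*lam/2)), by positivity, min_le_left _ _,
      (min_le_right _ _).trans (min_le_left _ _), (min_le_right _ _).trans (min_le_right _ _)⟩
  have hq0i : IntegrableOn q0 (Ioi 0) := by
    have hmeas : AEStronglyMeasurable q0 (volume.restrict (Ioi 0)) := by
      have m1 : AEStronglyMeasurable (fun t => B (x t) - b) (volume.restrict (Ioi 0)) := by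
        refine ContinuousOn.aestronglyMeasurable ?_ measurableSet_Ioi
        exact (hBc.comp_continuousOn ((locac_cont hx).mono Ioi_subset_Ici_self)).sub
          continuousOn_const
      exact ((m1.norm.pow 2).add ((locac_meas hv).norm.pow 2)).add ((locac_meas hx).norm.pow 2)
    have hen := energy (q := fun t => δ * q0 t) (m := -Φz + c * (Φz + ⟪b, z⟫))
      (F := fun t => (lam / 2 * ⟪x t - z, x t - z⟫ - φ t - ⟪v t, z - x t⟫) +
        c * (1 / 2 * ⟪v t + b, v t + b⟫ + (φ t + ⟪b, x t⟫)))
      (F' := fun t => (- ⟪v t + B (x t), x t - z⟫) + c * (⟪v t + b, v' t⟫ + ⟪v t + b, x' t⟫))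
      (fun T hT => (hEac T hT).add ((hPac T hT).const_mul c)) ?_ ?_ ?_
      (hmeas.const_mul δ) ?_
    · have := hen.2.const_mul δ⁻¹
      refine this.congr (Eventually.of_forall fun t => ?_)
      show δ⁻¹ * (δ * q0 t) = q0 t
      field_simp
    · filter_upwards [hEd, hPd] with t h1 h2 ht
      exact (h1 ht).add ((h2 ht).const_mul c)
    · filter_upwards [hdx, hdv, heq'] with t h1 h2 h3 ht
      have hnn := inner_deriv_nonneg ht hmono (h1 ht) (h2 ht)
      have h3 := h3 ht
      have e : v t + b = - (lam • x' t + v' t + (B (x t) - b)) := by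
        rw [eq_neg_iff_add_eq_zero, ← h3]; abel
      have e1 : ⟪v t + b, v' t⟫ ≤ - (1/2) * ‖v' t‖ ^ 2 + 1/2 * ‖B (x t) - b‖ ^ 2 := by
        rw [e]
        simp only [inner_neg_left, inner_add_left, inner_smul_left, conj_trivial]
        rw [real_inner_self_eq_norm_sq, real_inner_comm]
        have a1 := abs_le.1 (abs_real_inner_le_norm (B (x t) - b) (v' t))
        have a2 := mul_nonneg hlam.le hnn
        nlinarith [sq_nonneg (‖B (x t) - b‖ - ‖v' t‖)]
      have e2 : ⟪v t + b, x' t⟫ ≤ - (lam/2) * ‖x' t‖ ^ 2 + 1/(2*lam) * ‖B (x t) - b‖ ^ 2 := by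
        rw [e]
        simp only [inner_neg_left, inner_add_left, inner_smul_left, conj_trivial]
        rw [real_inner_self_eq_norm_sq]
        have a1 := abs_le.1 (abs_real_inner_le_norm (B (x t) - b) (x' t))
        have a3 : ‖B (x t) - b‖ * ‖x' t‖ ≤ lam/2 * ‖x' t‖ ^ 2 + 1/(2*lam) * ‖B (x t) - b‖ ^ 2 := by
          have : lam/2 * ‖x' t‖ ^ 2 + 1/(2*lam) * ‖B (x t) - b‖ ^ 2 - ‖B (x t) - b‖ * ‖x' t‖
            = 1/(2*lam) * (‖B (x t) - b‖ - lam * ‖x' t‖) ^ 2 := by field_simp; ring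
          have : 0 ≤ 1/(2*lam) * (‖B (x t) - b‖ - lam * ‖x' t‖) ^ 2 := by positivity
          linarith
        linarith
      have e3 := hEle t ht
      have e4 := mul_le_mul_of_nonneg_left (add_le_add e1 e2) hc.le
      have f1 := mul_le_mul_of_nonneg_right hδ1 (sq_nonneg ‖B (x t) - b‖)
      have f2 := mul_le_mul_of_nonneg_right hδ2 (sq_nonneg ‖v' t‖)
      have f3 := mul_le_mul_of_nonneg_right hδ3 (sq_nonneg ‖x' t‖)
      have f4 : c * (1/2 + 1/(2*lam)) * ‖B (x t) - b‖ ^ 2 = β / 2 * ‖B (x t) - b‖ ^ 2 := by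
        rw [hc1]
      show _ ≤ - (δ * (‖B (x t) - b‖ ^ 2 + ‖v' t‖ ^ 2 + ‖x' t‖ ^ 2))
      linarith
    · intro t
      show 0 ≤ δ * (‖B (x t) - b‖ ^ 2 + ‖v' t‖ ^ 2 + ‖x' t‖ ^ 2)
      positivity
    · intro t ht
      have h1 := hE0 t ht
      have h2 := hz1 t ht
      rw [inner_neg_left, inner_sub_right] at h2
      have h3 : 0 ≤ 1 / 2 * ⟪v t + b, v t + b⟫ := by
        rw [real_inner_self_eq_norm_sq]; positivity
      have h4 := mul_le_mul_of_nonneg_left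
        (show Φz + ⟪b, z⟫ ≤ 1 / 2 * ⟪v t + b, v t + b⟫ + (φ t + ⟪b, x t⟫) by linarith) hc.le
      linarith
  have hq1 := hq0i.const_mul (3 * (1 + lam ^ 2))
  have hge : ∀ t, q0 t ≤ 3 * (1 + lam ^ 2) * q0 t := by
    intro t
    have h0 : 0 ≤ q0 t := by positivity
    nlinarith [mul_nonneg (sq_nonneg lam) h0]
  have hx'q : ∀ t, ‖x' t‖ ^ 2 ≤ 3 * (1 + lam ^ 2) * q0 t := fun t => by
    refine le_trans ?_ (hge t)
    show ‖x' t‖ ^ 2 ≤ ‖B (x t) - b‖ ^ 2 + ‖v' t‖ ^ 2 + ‖x' t‖ ^ 2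
    nlinarith [sq_nonneg ‖B (x t) - b‖, sq_nonneg ‖v' t‖]
  have hv'q : ∀ t, ‖v' t‖ ^ 2 ≤ 3 * (1 + lam ^ 2) * q0 t := fun t => by
    refine le_trans ?_ (hge t)
    show ‖v' t‖ ^ 2 ≤ ‖B (x t) - b‖ ^ 2 + ‖v' t‖ ^ 2 + ‖x' t‖ ^ 2
    nlinarith [sq_nonneg ‖B (x t) - b‖, sq_nonneg ‖x' t‖]
  have hBq : ∀ t, ‖B (x t) - b‖ ^ 2 ≤ 3 * (1 + lam ^ 2) * q0 t := fun t => by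
    refine le_trans ?_ (hge t)
    show ‖B (x t) - b‖ ^ 2 ≤ ‖B (x t) - b‖ ^ 2 + ‖v' t‖ ^ 2 + ‖x' t‖ ^ 2
    nlinarith [sq_nonneg ‖v' t‖, sq_nonneg ‖x' t‖]
  have hBlim : Tendsto (fun t => B (x t) - b) atTop (𝓝 0) := by
    refine barbalat (K := 1/β) hx ?_ hq1 (Eventually.of_forall fun t _ => hx'q t)
      (Eventually.of_forall fun t _ => hBq t)
    intro s t _ _
    rw [sub_sub_sub_cancel_right]; exact hlip _ _
  have hvlim : Tendsto (fun t => v t + b) atTop (𝓝 0) := by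
    refine barbalat (K := 1) hv ?_ hq1 (Eventually.of_forall fun t _ => hv'q t) ?_
    · intro s t _ _
      rw [add_sub_add_right_eq_sub, one_mul]
    · filter_upwards [heq'] with t h3 ht
      have h3 := h3 ht
      have e : v t + b = - (lam • x' t + v' t + (B (x t) - b)) := by
        rw [eq_neg_iff_add_eq_zero, ← h3]; abel
      have h4 : ‖v t + b‖ ≤ lam * ‖x' t‖ + ‖v' t‖ + ‖B (x t) - b‖ := by
        rw [e, norm_neg]
        refine (norm_add₃_le).trans ?_
        rw [norm_smul, Real.norm_of_nonneg hlam.le]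
      have h5 := pow_le_pow_left₀ (norm_nonneg _) h4 2
      refine h5.trans ?_
      show _ ≤ 3 * (1 + lam ^ 2) * (‖B (x t) - b‖ ^ 2 + ‖v' t‖ ^ 2 + ‖x' t‖ ^ 2)
      generalize ‖x' t‖ = p
      generalize ‖v' t‖ = r
      generalize ‖B (x t) - b‖ = s
      nlinarith [sq_nonneg (lam * p - r), sq_nonneg (lam * p - s), sq_nonneg (r - s),
        sq_nonneg p, sq_nonneg (lam * r), sq_nonneg (lam * s)]
  constructor
  · have := hvlim.sub_const b
    simpa using this
  · have := hBlim.add_const b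
    simpa using this

lemma weak_strong {U : Filter ℝ} {x v : ℝ → H} {xb p : H} {R : ℝ}
    (hb : ∀ᶠ t in U, ‖x t‖ ≤ R)
    (hx : ∀ w : H, Tendsto (fun t => ⟪x t, w⟫) U (𝓝 ⟪xb, w⟫))
    (hv : Tendsto v U (𝓝 p)) : Tendsto (fun t => ⟪v t, x t⟫) U (𝓝 ⟪p, xb⟫) := by
  have h1 : Tendsto (fun t => ⟪v t - p, x t⟫) U (𝓝 0) := by
    have h2 := ((tendsto_iff_norm_sub_tendsto_zero.1 hv).mul_const R)
    rw [zero_mul] at h2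
    refine squeeze_zero_norm' ?_ h2
    filter_upwards [hb] with t ht
    exact (norm_inner_le_norm _ _).trans (mul_le_mul_of_nonneg_left ht (norm_nonneg _))
  have h2 := h1.add (hx p)
  rw [zero_add, real_inner_comm] at h2
  refine h2.congr fun t => ?_
  rw [inner_sub_left, real_inner_comm p (x t)]; ring

lemma weak_limit [CompleteSpace H] (U : Ultrafilter ℝ) {x : ℝ → H} {R : ℝ}
    (hb : ∀ᶠ t in (U : Filter ℝ), ‖x t‖ ≤ R) :
    ∃ xb : H, ∀ w : H, Tendsto (fun t => ⟪x t, w⟫) U (𝓝 ⟪xb, w⟫) := by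
  let f : ℝ → WeakDual ℝ H := fun t => StrongDual.toWeakDual (InnerProductSpace.toDual ℝ H (x t))
  have hc := WeakDual.isCompact_closedBall (𝕜 := ℝ) (E := H) 0 R
  obtain ⟨g, -, hg⟩ := hc.ultrafilter_le_nhds (U.map f) (by
    rw [le_principal_iff]
    refine Ultrafilter.mem_map.2 ?_
    refine mem_of_superset hb fun t ht => ?_
    simpa [f] using ht)
  refine ⟨(InnerProductSpace.toDual ℝ H).symm (WeakDual.toStrongDual g), fun w => ?_⟩
  have h1 : Tendsto f U (𝓝 g) := hg
  have h2 := ((WeakDual.eval_continuous w).tendsto g).comp h1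
  rw [InnerProductSpace.toDual_symm_apply]
  exact h2

lemma closed_subdiff [CompleteSpace H] {Φ : H → EReal}
    (hbot : ∀ x, Φ x ≠ ⊥)
    (hconvex : ∀ x y : H, ∀ a b : ℝ, 0 ≤ a → 0 ≤ b → a + b = 1 →
      Φ (a • x + b • y) ≤ (a : EReal) * Φ x + (b : EReal) * Φ y)
    (hlsc : LowerSemicontinuous Φ)
    {U : Filter ℝ} [U.NeBot] {x v : ℝ → H} {xb p : H} {R : ℝ}
    (hb : ∀ᶠ t in U, ‖x t‖ ≤ R)
    (hx : ∀ w : H, Tendsto (fun t => ⟪x t, w⟫) U (𝓝 ⟪xb, w⟫))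
    (hv : Tendsto v U (𝓝 p)) (hs : ∀ᶠ t in U, InSubdiff Φ (x t) (v t)) :
    InSubdiff Φ xb p := by
  intro y
  by_cases hy : Φ y = ⊤
  · rw [hy]; exact le_top
  lift Φ y to ℝ using ⟨hy, hbot y⟩ with Y hY
  have hlim : Tendsto (fun t => ⟪v t, y - x t⟫) U (𝓝 ⟪p, y - xb⟫) := by
    have h1 : Tendsto (fun t => ⟪v t, y⟫) U (𝓝 ⟪p, y⟫) := hv.inner tendsto_const_nhds
    have := h1.sub (weak_strong hb hx hv)
    simpa only [inner_sub_right] using this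
  set c := ⟪p, y - xb⟫ with hc
  have key : ∀ r : ℝ, Y - c < r → Φ xb ≤ r := by
    intro r hr
    by_contra hcon
    have hconv : Convex ℝ {w | Φ w ≤ (r : EReal)} := by
      intro w1 h1 w2 h2 a b ha hb hab
      refine (hconvex w1 w2 a b ha hb hab).trans ?_
      have e1 : (a : EReal) * Φ w1 ≤ (a : EReal) * r :=
        mul_le_mul_of_nonneg_left h1 (by exact_mod_cast ha)
      have e2 : (b : EReal) * Φ w2 ≤ (b : EReal) * r :=
        mul_le_mul_of_nonneg_left h2 (by exact_mod_cast hb)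
      refine (add_le_add e1 e2).trans (le_of_eq ?_)
      norm_cast
      rw [← add_mul, hab, one_mul]
    have hcl : IsClosed {w | Φ w ≤ (r : EReal)} := hlsc.isClosed_preimage _
    obtain ⟨f, u, hf1, hf2⟩ := geometric_hahn_banach_point_closed hconv hcl hcon
    have hft : Tendsto (fun t => f (x t)) U (𝓝 (f xb)) := by
      have h2 : ∀ w, ⟪w, (InnerProductSpace.toDual ℝ H).symm f⟫ = f w := fun w => by
        rw [real_inner_comm, InnerProductSpace.toDual_symm_apply]
      simpa only [h2] using hx ((InnerProductSpace.toDual ℝ H).symm f)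
    have hev : ∀ᶠ t in U, False := by
      filter_upwards [hft.eventually (gt_mem_nhds hf1), hs,
        hlim.eventually (lt_mem_nhds (show Y - r < c by linarith))] with t h1 h2 h3
      have h4 := h2 y
      rw [← hY] at h4
      have hne : Φ (x t) ≠ ⊤ := by
        intro h; rw [h] at h4; simp at h4
      have h5 : Φ (x t) ≤ r := by
        lift Φ (x t) to ℝ using ⟨hne, hbot _⟩ with ξ
        norm_cast at h4 ⊢
        linarith
      exact absurd (hf2 _ h5) (not_lt.2 h1.le)
    exact hev.exists.elim fun _ h => h
  have hne : Φ xb ≠ ⊤ := fun h => by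
    have := key (Y - c + 1) (by linarith)
    rw [h] at this
    exact EReal.coe_ne_top _ (top_le_iff.1 this)
  lift Φ xb to ℝ using ⟨hne, hbot _⟩ with ξ
  norm_cast at key ⊢
  have : ξ ≤ Y - c := le_of_forall_gt_imp_ge_of_dense key
  linarith
end

/-- Convergence of the regularized Newton dynamic: the orbit `x` converges
weakly to a zero of `∂Φ + B`, `v + B(x) → 0` strongly, and `B(x(t))`
converges strongly to the common value of `B` on the solution set. -/
theorem newton_dynamic_convergence
    {H : Type*} [NormedAddCommGroup H] [InnerProductSpace ℝ H] [CompleteSpace H]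
    (Φ : H → EReal)
    (hproper : (∀ x, Φ x ≠ ⊥) ∧ ∃ x, Φ x ≠ ⊤)
    (hconvex : ∀ x y : H, ∀ a b : ℝ, 0 ≤ a → 0 ≤ b → a + b = 1 →
      Φ (a • x + b • y) ≤ (a : EReal) * Φ x + (b : EReal) * Φ y)
    (hlsc : LowerSemicontinuous Φ)
    (β : ℝ) (hβ : 0 < β) (B : H → H)
    (hcoco : ∀ x y : H, β * ‖B x - B y‖ ^ 2 ≤ ⟪B x - B y, x - y⟫)
    (lam : ℝ) (hlam : 0 < lam)
    (x v x' v' : ℝ → H)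
    (hx : IsLocAC x x') (hv : IsLocAC v v')
    (hsub : ∀ t : ℝ, 0 ≤ t → InSubdiff Φ (x t) (v t))
    (heq : ∀ᵐ t ∂(volume.restrict (Ioi (0 : ℝ))),
      lam • x' t + v' t + v t + B (x t) = 0)
    (hS : ∃ z : H, InSubdiff Φ z (-B z)) :
    ∃ xinf : H, InSubdiff Φ xinf (-B xinf) ∧
      (∀ w : H, Tendsto (fun t => ⟪x t, w⟫) atTop (nhds ⟪xinf, w⟫)) ∧
      Tendsto (fun t => ‖v t + B (x t)‖) atTop (nhds 0) ∧
      Tendsto (fun t => B (x t)) atTop (nhds (B xinf)) := by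
  obtain ⟨z0, hz0⟩ := hS
  obtain ⟨hbot, y0, hy0⟩ := hproper
  have hfin : ∀ y w : H, InSubdiff Φ y w → Φ y ≠ ⊤ := by
    intro y w h htop
    have h1 := h y0
    rw [htop, EReal.top_add_coe, top_le_iff] at h1
    exact hy0 h1
  have hreal : ∀ y w y2 w2 : H, InSubdiff Φ y w → InSubdiff Φ y2 w2 →
      (Φ y).toReal + ⟪w, y2 - y⟫ ≤ (Φ y2).toReal := by
    intro y w y2 w2 h h2
    have h1 := h y2
    have f1 := hfin y w h
    have f2 := hfin y2 w2 h2
    rw [← EReal.coe_toReal f1 (hbot y), ← EReal.coe_toReal f2 (hbot y2)] at h1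
    exact_mod_cast h1
  let φ : ℝ → ℝ := fun t => (Φ (x t)).toReal
  have hφ : ∀ s t, 0 ≤ s → 0 ≤ t → φ s + ⟪v s, x t - x s⟫ ≤ φ t := fun s t hs ht =>
    hreal _ _ _ _ (hsub s hs) (hsub t ht)
  have hcore := fun (z : H) (hz : InSubdiff Φ z (-B z)) =>
    core (Φz := (Φ z).toReal) hβ hcoco hlam hx hv hφ heq
      (fun t ht => hreal _ _ _ _ hz (hsub t ht)) (fun t ht => hreal _ _ _ _ (hsub t ht) hz)
  have hElow : ∀ (z : H), InSubdiff Φ z (-B z) → ∀ t, 0 ≤ t →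
      -(Φ z).toReal + lam / 2 * ‖x t - z‖ ^ 2 ≤
        lam / 2 * ⟪x t - z, x t - z⟫ - φ t - ⟪v t, z - x t⟫ := by
    intro z hz t ht
    have h1 : φ t + ⟪v t, z - x t⟫ ≤ (Φ z).toReal := hreal _ _ _ _ (hsub t ht) hz
    rw [real_inner_self_eq_norm_sq]
    linarith
  have hElim : ∀ (z : H), InSubdiff Φ z (-B z) → ∃ l, Tendsto
      (fun t => lam / 2 * ⟪x t - z, x t - z⟫ - φ t - ⟪v t, z - x t⟫) atTop (𝓝 l) := by
    intro z hz
    refine antitone_lim (m := -(Φ z).toReal) (hcore z hz).1 fun t ht => ?_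
    have h1 := hElow z hz t ht
    have h2 : 0 ≤ lam / 2 * ‖x t - z‖ ^ 2 := by positivity
    linarith
  obtain ⟨hant, hvlim, hBlim⟩ := hcore z0 hz0
  -- boundedness
  obtain ⟨R, hR⟩ : ∃ R, ∀ t, 0 ≤ t → ‖x t‖ ≤ R := by
    set K := (lam / 2 * ⟪x 0 - z0, x 0 - z0⟫ - φ 0 - ⟪v 0, z0 - x 0⟫ + (Φ z0).toReal) / (lam / 2)
    refine ⟨‖z0‖ + (1 + K), fun t ht => ?_⟩
    have h1 := hElow z0 hz0 t ht
    have h2 := hant (mem_Ici.2 le_rfl) (mem_Ici.2 ht) ht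
    simp only at h2
    have h3 : ‖x t - z0‖ ^ 2 ≤ K := by
      rw [le_div_iff₀ (by positivity)]; linarith
    have h4 : ‖x t - z0‖ ≤ 1 + K := by nlinarith [sq_nonneg (‖x t - z0‖ - 1), norm_nonneg (x t - z0)]
    have h5 := norm_add_le z0 (x t - z0)
    rw [add_sub_cancel] at h5
    linarith
  -- weak cluster points
  have hclus : ∀ U : Ultrafilter ℝ, (U : Filter ℝ) ≤ atTop → ∃ xb : H,
      (∀ w : H, Tendsto (fun t => ⟪x t, w⟫) U (𝓝 ⟪xb, w⟫)) ∧ B xb = B z0 ∧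
        InSubdiff Φ xb (-B xb) := by
    intro U hU
    have hb : ∀ᶠ t in (U : Filter ℝ), ‖x t‖ ≤ R :=
      hU ((eventually_ge_atTop 0).mono fun t ht => hR t ht)
    obtain ⟨xb, hxb⟩ := weak_limit U hb
    have hB : B xb = B z0 := by
      have h1 : Tendsto (fun t => B (x t) - B xb) U (𝓝 (B z0 - B xb)) :=
        (hBlim.mono_left hU).sub_const _
      have h2 := (weak_strong hb hxb h1).sub (h1.inner (tendsto_const_nhds (x := xb)) (𝕜 := ℝ))
      rw [sub_self] at h2
      have h3 := (h1.norm.pow 2).const_mul β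
      have h4 := le_of_tendsto_of_tendsto' h3 h2 fun t => by
        have := hcoco (x t) xb
        rwa [inner_sub_right] at this
      have h5 : ‖B z0 - B xb‖ ^ 2 ≤ 0 := by
        by_contra! hcon
        have := mul_pos hβ hcon
        linarith
      have h6 : ‖B z0 - B xb‖ = 0 := by
        have := sq_nonneg ‖B z0 - B xb‖
        exact pow_eq_zero_iff (two_ne_zero) |>.1 (le_antisymm h5 this)
      exact (sub_eq_zero.1 (norm_eq_zero.1 h6)).symm
    refine ⟨xb, hxb, hB, ?_⟩
    rw [hB]
    exact closed_subdiff hbot hconvex hlsc hb hxb (hvlim.mono_left hU)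
      (hU ((eventually_ge_atTop 0).mono fun t ht => hsub t ht))
  have huniq : ∀ z1 z2 : H, InSubdiff Φ z1 (-B z1) → InSubdiff Φ z2 (-B z2) →
      ∃ l, Tendsto (fun t => ⟪x t, z1 - z2⟫) atTop (𝓝 l) := by
    intro z1 z2 h1 h2
    obtain ⟨l1, hl1⟩ := hElim z1 h1
    obtain ⟨l2, hl2⟩ := hElim z2 h2
    have h3 : Tendsto (fun t => ⟪v t, z1 - z2⟫) atTop (𝓝 ⟪-B z0, z1 - z2⟫) :=
      hvlim.inner tendsto_const_nhds
    have h4 := ((((hl1.sub hl2).add h3).sub_const (lam / 2 * (⟪z1, z1⟫ - ⟪z2, z2⟫))).const_mul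
      (-(1 / lam)))
    refine ⟨_, h4.congr fun t => ?_⟩
    simp only [inner_sub_left, inner_sub_right, real_inner_comm (x t) z1, real_inner_comm (x t) z2]
    field_simp
    ring
  obtain ⟨xinf, hw, hBx, hxS⟩ := hclus (Ultrafilter.of atTop) (Ultrafilter.of_le _)
  refine ⟨xinf, hxS, ?_, ?_, ?_⟩
  · intro w
    rw [tendsto_iff_ultrafilter]
    intro U hU
    obtain ⟨xb, hwb, -, hbS⟩ := hclus U hU
    obtain ⟨l, hl⟩ := huniq xinf xb hxS hbS
    have e1 := tendsto_nhds_unique (hw (xinf - xb)) (hl.mono_left (Ultrafilter.of_le _))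
    have e2 := tendsto_nhds_unique (hwb (xinf - xb)) (hl.mono_left hU)
    have e3 : ⟪xinf - xb, xinf - xb⟫ = 0 := by
      rw [inner_sub_left, e1, e2, sub_self]
    have e4 : xinf = xb := sub_eq_zero.1 (inner_self_eq_zero.1 e3)
    rw [e4]
    exact hwb w
  · have := (hvlim.add hBlim).norm
    simpa using this
  · rw [hBx]; exact hBlim
end

section
/- If Φ is strongly convex (with modulus γ > 0) and B is β-cocoercive, then the inclusion 0 ∈ ∂Φ(z) + Bz has exactly one solution z̄, and every orbit of the regularized Newton dynamic v(t) ∈ ∂Φ(x(t)), λẋ(t) + v̇(t) + v(t) + B(x(t)) = 0 converges strongly to z̄. -/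
open scoped RealInnerProductSpace
open MeasureTheory Filter Set

theorem aux_ne_top {H : Type*} [NormedAddCommGroup H] [InnerProductSpace ℝ H]
    {Φ : H → EReal} (hproper : (∀ x, Φ x ≠ ⊥) ∧ ∃ x, Φ x ≠ ⊤) {p g : H}
    (h : InSubdiff Φ p g) : Φ p ≠ ⊤ := by
  obtain ⟨q, hq⟩ := hproper.2
  intro hp
  have := h q
  rw [hp, EReal.top_add_coe, top_le_iff] at this
  exact hq this

theorem aux_real {H : Type*} [NormedAddCommGroup H] [InnerProductSpace ℝ H]
    {Φ : H → EReal} (hproper : (∀ x, Φ x ≠ ⊥) ∧ ∃ x, Φ x ≠ ⊤) {p g q : H}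
    (h : InSubdiff Φ p g) (hq : Φ q ≠ ⊤) :
    (Φ p).toReal + ⟪g, q - p⟫ ≤ (Φ q).toReal := by
  have h1 := h q
  rw [← EReal.coe_toReal (aux_ne_top hproper h) (hproper.1 p),
    ← EReal.coe_toReal hq (hproper.1 q), ← EReal.coe_add, EReal.coe_le_coe_iff] at h1
  exact h1

theorem aux_mono {H : Type*} [NormedAddCommGroup H] [InnerProductSpace ℝ H]
    {Φ : H → EReal} (hproper : (∀ x, Φ x ≠ ⊥) ∧ ∃ x, Φ x ≠ ⊤) {γ : ℝ}
    (hstrconv : ∀ x y : H, ∀ a b : ℝ, 0 ≤ a → 0 ≤ b → a + b = 1 →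
      Φ (a • x + b • y) ≤ (a : EReal) * Φ x + (b : EReal) * Φ y
        - ((γ / 2 * a * b * ‖x - y‖ ^ 2 : ℝ) : EReal))
    {p g q k : H} (hp : InSubdiff Φ p g) (hq : InSubdiff Φ q k) :
    γ / 2 * ‖p - q‖ ^ 2 ≤ ⟪g - k, p - q⟫ := by
  have h := hstrconv p q (1/2) (1/2) (by norm_num) (by norm_num) (by norm_num)
  have hpt := aux_ne_top hproper hp
  have hqt := aux_ne_top hproper hq
  rw [← EReal.coe_toReal hpt (hproper.1 p),
    ← EReal.coe_toReal hqt (hproper.1 q), ← EReal.coe_mul, ← EReal.coe_mul, ← EReal.coe_add,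
    ← EReal.coe_sub] at h
  have hm : Φ ((1/2 : ℝ) • p + (1/2 : ℝ) • q) ≠ ⊤ := by
    intro h'
    rw [h', top_le_iff] at h
    exact EReal.coe_ne_top _ h
  rw [← EReal.coe_toReal hm (hproper.1 _), EReal.coe_le_coe_iff] at h
  have h1 := aux_real hproper hp hm
  have h2 := aux_real hproper hq hm
  have e1 : (1/2 : ℝ) • p + (1/2 : ℝ) • q - p = (-(1/2) : ℝ) • (p - q) := by module
  have e2 : (1/2 : ℝ) • p + (1/2 : ℝ) • q - q = (1/2 : ℝ) • (p - q) := by module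
  rw [e1, inner_smul_right] at h1
  rw [e2, inner_smul_right] at h2
  rw [inner_sub_left]
  linarith

theorem aux_cont {H : Type*} [NormedAddCommGroup H] [NormedSpace ℝ H]
    {x x' : ℝ → H} (h : IsLocAC x x') : ContinuousOn x (Ici 0) := by
  intro t ht
  have ht : 0 ≤ t := ht
  have h1 := intervalIntegral.continuousOn_primitive_interval (h.1 0 (t+1) le_rfl (by linarith))
  rw [uIcc_of_le (by linarith)] at h1
  have h2 : ContinuousOn x (Icc 0 (t+1)) := by
    refine (h1.add (continuousOn_const (c := x 0))).congr ?_
    intro s hs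
    have := h.2 0 s le_rfl hs.1
    change x s = (∫ u in (0:ℝ)..s, x' u) + x 0
    rw [← this, sub_add_cancel]
  refine (h2 t ⟨ht, by linarith⟩).mono_of_mem_nhdsWithin ?_
  rw [← Ici_inter_Iic]
  exact inter_mem self_mem_nhdsWithin (mem_nhdsWithin_of_mem_nhds (Iic_mem_nhds (by linarith)))

theorem aux_B {H : Type*} [NormedAddCommGroup H] [InnerProductSpace ℝ H]
    {β : ℝ} (hβ : 0 < β) {B : H → H}
    (hcoco : ∀ x y : H, β * ‖B x - B y‖ ^ 2 ≤ ⟪B x - B y, x - y⟫) : Continuous B := by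
  refine LipschitzWith.continuous (K := (β⁻¹).toNNReal) (LipschitzWith.of_dist_le_mul ?_)
  intro p q
  rw [dist_eq_norm, dist_eq_norm, Real.coe_toNNReal _ (by positivity), inv_mul_eq_div,
    le_div_iff₀ hβ]
  have h := (hcoco p q).trans (real_inner_le_norm _ _)
  rcases (norm_nonneg (B p - B q)).eq_or_lt with h0 | h0
  · rw [← h0]; simp
  · by_contra! hc
    nlinarith [mul_lt_mul_of_pos_left hc h0]

theorem aux_deriv {H : Type*} [NormedAddCommGroup H] [InnerProductSpace ℝ H] [CompleteSpace H]
    {B : H → H} (hB : Continuous B) {lam : ℝ} {x v x' v' : ℝ → H}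
    (hx : IsLocAC x x') (hv : IsLocAC v v')
    (heq : ∀ᵐ t ∂(volume.restrict (Ioi (0 : ℝ))),
      lam • x' t + v' t + v t + B (x t) = 0) {s : ℝ} (hs : 0 ≤ s) :
    Tendsto (fun t => (t - s)⁻¹ • (lam • (x t - x s) + (v t - v s))) (nhdsWithin s (Ioi s))
      (nhds (-(v s + B (x s)))) := by
  set g : ℝ → H := fun u => -(v (max u 0) + B (x (max u 0))) with hg
  have hm : Continuous (fun u : ℝ => max u 0) := by fun_prop
  have hxc : Continuous (fun u : ℝ => x (max u 0)) :=
    (aux_cont hx).comp_continuous hm (fun u => mem_Ici.2 (le_max_right u 0))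
  have hvc : Continuous (fun u : ℝ => v (max u 0)) :=
    (aux_cont hv).comp_continuous hm (fun u => mem_Ici.2 (le_max_right u 0))
  have hgc : Continuous g := (hvc.add (hB.comp hxc)).neg
  have hd := (hgc.integral_hasStrictDerivAt s s).hasDerivAt.hasDerivWithinAt (s := Ioi s)
  rw [hasDerivWithinAt_iff_tendsto_slope' (by simp)] at hd
  have hgs : g s = -(v s + B (x s)) := by simp [hg, hs]
  rw [hgs] at hd
  refine hd.congr' ?_
  filter_upwards [self_mem_nhdsWithin] with t ht
  have ht : s < t := ht
  have ht0 : 0 ≤ t := hs.trans ht.le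
  rw [slope_def_module, intervalIntegral.integral_same, sub_zero, hx.2 s t hs ht0,
    hv.2 s t hs ht0, ← intervalIntegral.integral_smul lam, ← intervalIntegral.integral_add]
  · congr 1
    apply intervalIntegral.integral_congr_ae
    rw [ae_restrict_iff' measurableSet_Ioi] at heq
    filter_upwards [heq] with u hu hu'
    rw [uIoc_of_le ht.le] at hu'
    have hu0 : 0 < u := hs.trans_lt hu'.1
    have := hu hu0
    simp only [hg, max_eq_left hu0.le]
    rw [neg_eq_iff_add_eq_zero, ← this]
    abel
  · exact ((hx.1 s t hs ht0).intervalIntegrable).smul lam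
  · exact (hv.1 s t hs ht0).intervalIntegrable

/-- If `Φ` is `γ`-strongly convex, the inclusion `0 ∈ ∂Φ(z) + Bz` has a unique
solution `z̄`, and every orbit of the regularized Newton dynamic converges
strongly to `z̄`. -/
theorem newton_dynamic_strong_convergence
    {H : Type*} [NormedAddCommGroup H] [InnerProductSpace ℝ H] [CompleteSpace H]
    (Φ : H → EReal)
    (hproper : (∀ x, Φ x ≠ ⊥) ∧ ∃ x, Φ x ≠ ⊤)
    (hlsc : LowerSemicontinuous Φ)
    (γ : ℝ) (hγ : 0 < γ)
    (hstrconv : ∀ x y : H, ∀ a b : ℝ, 0 ≤ a → 0 ≤ b → a + b = 1 →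
      Φ (a • x + b • y) ≤ (a : EReal) * Φ x + (b : EReal) * Φ y
        - ((γ / 2 * a * b * ‖x - y‖ ^ 2 : ℝ) : EReal))
    (β : ℝ) (hβ : 0 < β) (B : H → H)
    (hcoco : ∀ x y : H, β * ‖B x - B y‖ ^ 2 ≤ ⟪B x - B y, x - y⟫)
    (lam : ℝ) (hlam : 0 < lam)
    (x v x' v' : ℝ → H)
    (hx : IsLocAC x x') (hv : IsLocAC v v')
    (hsub : ∀ t : ℝ, 0 ≤ t → InSubdiff Φ (x t) (v t))
    (heq : ∀ᵐ t ∂(volume.restrict (Ioi (0 : ℝ))),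
      lam • x' t + v' t + v t + B (x t) = 0)
    (hS : ∃ z : H, InSubdiff Φ z (-B z)) :
    ∃ zbar : H, InSubdiff Φ zbar (-B zbar) ∧
      (∀ z : H, InSubdiff Φ z (-B z) → z = zbar) ∧
      Tendsto x atTop (nhds zbar) := by
  obtain ⟨z, hz⟩ := hS
  have hBm : ∀ p q, 0 ≤ ⟪B p - B q, p - q⟫ := fun p q =>
    le_trans (by positivity) (hcoco p q)
  have hBc := aux_B hβ hcoco
  have hzt := aux_ne_top hproper hz
  refine ⟨z, hz, ?_, ?_⟩
  · intro y hy
    have h1 := aux_mono hproper hstrconv hy hz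
    have h2 := hBm y z
    have e : -B y - -B z = -(B y - B z) := by abel
    rw [e, inner_neg_left] at h1
    have h3 : ‖y - z‖ ^ 2 ≤ 0 := by
      by_contra! hc
      nlinarith [mul_pos hγ hc]
    have h4 : ‖y - z‖ = 0 := by
      have := sq_nonneg ‖y - z‖
      exact pow_eq_zero_iff (two_ne_zero) |>.1 (le_antisymm h3 this)
    exact sub_eq_zero.1 (norm_eq_zero.1 h4)
  have hxt : ∀ t, 0 ≤ t → Φ (x t) ≠ ⊤ := fun t ht => aux_ne_top hproper (hsub t ht)
  have hxc := aux_cont hx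
  have hvc := aux_cont hv
  set φ : ℝ → ℝ := fun t => (Φ (x t)).toReal with hφ
  have hφs : ∀ s t, 0 ≤ s → 0 ≤ t → φ s + ⟪v s, x t - x s⟫ ≤ φ t := fun s t hs ht =>
    aux_real hproper (hsub s hs) (hxt t ht)
  have hφc : ContinuousOn φ (Ici 0) := by
    intro s hs
    have hs0 : 0 ≤ s := hs
    have hxs : Tendsto x (nhdsWithin s (Ici 0)) (nhds (x s)) := hxc s hs
    have hvs : Tendsto v (nhdsWithin s (Ici 0)) (nhds (v s)) := hvc s hs
    have l1 : Tendsto (fun t => φ s + ⟪v s, x t - x s⟫) (nhdsWithin s (Ici 0)) (nhds (φ s)) := by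
      have := (tendsto_const_nhds (x := φ s)).add
        ((tendsto_const_nhds (x := v s)).inner (𝕜 := ℝ) (hxs.sub_const (x s)))
      simpa using this
    have l2 : Tendsto (fun t => φ s + ⟪v t, x t - x s⟫) (nhdsWithin s (Ici 0)) (nhds (φ s)) := by
      have := (tendsto_const_nhds (x := φ s)).add
        (hvs.inner (𝕜 := ℝ) (hxs.sub_const (x s)))
      simpa using this
    refine tendsto_of_tendsto_of_tendsto_of_le_of_le' l1 l2 ?_ ?_
    · filter_upwards [self_mem_nhdsWithin] with t ht using hφs s t hs0 ht
    · filter_upwards [self_mem_nhdsWithin] with t ht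
      have := hφs t s ht hs0
      have e : x s - x t = -(x t - x s) := by abel
      rw [e, inner_neg_right] at this
      linarith
  set E : ℝ → ℝ := fun t =>
    lam / 2 * ‖x t - z‖ ^ 2 + ((Φ z).toReal - φ t + ⟪v t, x t - z⟫) with hE
  have hEc : ContinuousOn E (Ici 0) := by
    have h1 : ContinuousOn (fun t => x t - z) (Ici 0) := hxc.sub continuousOn_const
    exact ((h1.norm.pow 2).const_mul _).add
      ((continuousOn_const.sub hφc).add (hvc.inner (𝕜 := ℝ) h1))
  have hElow : ∀ t, 0 ≤ t → lam / 2 * ‖x t - z‖ ^ 2 ≤ E t := by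
    intro t ht
    have := aux_real hproper (hsub t ht) hzt
    have e : z - x t = -(x t - z) := by abel
    rw [e, inner_neg_right] at this
    simp only [hE, hφ]
    linarith
  have hEdiff : ∀ s t, 0 ≤ s → 0 ≤ t →
      E t - E s ≤ ⟪lam • (x t - x s) + (v t - v s), x t - z⟫ := by
    intro s t hs ht
    have h1 := hφs s t hs ht
    have e : x t - x s = (x t - z) - (x s - z) := by abel
    have h2 : 0 ≤ ‖(x t - z) - (x s - z)‖ ^ 2 := by positivity
    rw [norm_sub_sq_real] at h2
    rw [e, inner_sub_right] at h1
    simp only [hE]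
    rw [e, inner_add_left, inner_smul_left, inner_sub_left (x t - z), inner_sub_left (v t),
      real_inner_self_eq_norm_sq, real_inner_comm (x t - z) (x s - z)]
    simp only [conj_trivial]
    nlinarith [mul_nonneg hlam.le h2]
  have hc : 0 < γ / (lam + γ) := by positivity
  have hbound : ∀ t, 0 ≤ t → ⟪-(v t + B (x t)), x t - z⟫ ≤ -(γ / (lam + γ)) * E t + 0 := by
    intro t ht
    have h1 := aux_mono hproper hstrconv (hsub t ht) hz
    have h2 := hBm (x t) z
    have h3 := aux_real hproper hz (hxt t ht)
    have hM : E t ≤ lam / 2 * ‖x t - z‖ ^ 2 + ⟪v t - -B z, x t - z⟫ := by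
      simp only [hE, hφ]
      rw [inner_sub_left]
      linarith
    have e : -(v t + B (x t)) = -(v t - -B z) - (B (x t) - B z) := by abel
    rw [e, inner_sub_left, inner_neg_left]
    generalize ⟪v t - -B z, x t - z⟫ = M at *
    have h4 : γ / (lam + γ) * E t ≤ M := by
      rw [div_mul_eq_mul_div, div_le_iff₀ (by positivity)]
      nlinarith [mul_le_mul_of_nonneg_left hM hγ.le, mul_le_mul_of_nonneg_left h1 hlam.le]
    linarith
  have hexp : ∀ t, 0 ≤ t → E t ≤ E 0 * Real.exp (-(γ / (lam + γ)) * t) := by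
    intro t ht
    have := le_gronwallBound_of_liminf_deriv_right_le (f := E)
      (f' := fun t => ⟪-(v t + B (x t)), x t - z⟫) (δ := E 0) (K := -(γ / (lam + γ))) (ε := 0)
      (a := 0) (b := t) (hEc.mono Icc_subset_Ici_self) ?_ le_rfl
      (fun s hs => hbound s hs.1) t ⟨ht, le_rfl⟩
    · rwa [gronwallBound_ε0, sub_zero] at this
    · intro s hs r hr
      apply Eventually.frequently
      have hxs : Tendsto x (nhdsWithin s (Ioi s)) (nhds (x s)) :=
        (hxc s hs.1).mono_left (nhdsWithin_mono _ (fun u hu => hs.1.trans (le_of_lt hu)))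
      have hl := (aux_deriv hBc hx hv heq hs.1).inner (𝕜 := ℝ) (hxs.sub_const z)
      filter_upwards [hl.eventually_lt_const hr, self_mem_nhdsWithin] with u hu hus
      have hus : s < u := hus
      refine lt_of_le_of_lt ?_ hu
      rw [inner_smul_left]
      exact mul_le_mul_of_nonneg_left (hEdiff s u hs.1 (hs.1.trans hus.le))
        (inv_nonneg.2 (sub_nonneg.2 hus.le))
  have hlim : Tendsto (fun t => 2 / lam * (E 0 * Real.exp (-(γ / (lam + γ)) * t))) atTop
      (nhds 0) := by
    have h1 : Tendsto (fun t : ℝ => -(γ / (lam + γ)) * t) atTop atBot :=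
      tendsto_id.const_mul_atTop_of_neg (by linarith)
    have := ((Real.tendsto_exp_atBot.comp h1).const_mul (E 0)).const_mul (2 / lam)
    simpa using this
  have hsq : Tendsto (fun t => ‖x t - z‖ ^ 2) atTop (nhds 0) := by
    refine tendsto_of_tendsto_of_tendsto_of_le_of_le' tendsto_const_nhds hlim
      (Eventually.of_forall fun t => by positivity) ?_
    filter_upwards [eventually_ge_atTop 0] with t ht
    have h1 := (hElow t ht).trans (hexp t ht)
    have h2 := mul_le_mul_of_nonneg_left h1 (by positivity : 0 ≤ 2 / lam)
    have e : 2 / lam * (lam / 2 * ‖x t - z‖ ^ 2) = ‖x t - z‖ ^ 2 := by field_simp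
    rwa [e] at h2
  rw [tendsto_iff_norm_sub_tendsto_zero]
  have := hsq.sqrt
  simpa [Real.sqrt_sq (norm_nonneg _)] using this
end
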